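/- Fix integers k ≥ 2 and m ≥ 0, a real p ∈ [1,∞), and constants C_F, c₁, c₂ > 0. There exists C > 0, depending only on k, m, p, C_F, c₁, c₂, such that for every h ∈ (0,1], every map F : ℝ² → ℝ² with polynomial components of total degree ≤ k satisfying the isoparametric bounds of order k (with constants C_F, c₁, c₂ and parameter h), every measurable set K̂ ⊂ T̂ with K := F(K̂), and every function ŵ : ℝ² → ℝ² that is smooth on a neighborhood of the closure of T̂, the function w := ŵ ∘ F⁻¹ on F(T̂) satisfies |ŵ|_{W^{m,p}(K̂)} ≤ C h^{m − 2/p} Σ_{r=0}^{m} |w|_{W^{r,p}(K)}. -/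

import Mathlib

open Set MeasureTheory Function

noncomputable section

/-- The open reference triangle with vertices (0,0), (1,0), (0,1). -/
def Tref : Set (ℝ × ℝ) := {x | 0 < x.1 ∧ 0 < x.2 ∧ x.1 + x.2 < 1}

/-- The three vertices of the reference triangle. -/
def vtx : Fin 3 → ℝ × ℝ := ![(0, 0), (1, 0), (0, 1)]

/-- The (open) Clough–Tocher subtriangles, obtained by connecting the barycenter
to the vertices. -/
def ctK (i : Fin 3) : Set (ℝ × ℝ) :=
  interior (convexHull ℝ {vtx i, vtx (i + 1), ((1 : ℝ) / 3, (1 : ℝ) / 3)})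

/-- A map `ℝ² → ℝ²` whose two components are polynomials of total degree ≤ k. -/
def IsPolyMap (k : ℕ) (F : ℝ × ℝ → ℝ × ℝ) : Prop :=
  ∃ P Q : MvPolynomial (Fin 2) ℝ, P.totalDegree ≤ k ∧ Q.totalDegree ≤ k ∧
    ∀ x : ℝ × ℝ,
      F x = (MvPolynomial.eval ![x.1, x.2] P, MvPolynomial.eval ![x.1, x.2] Q)

/-- The Jacobian determinant of `F`. -/
def jacDet (F : ℝ × ℝ → ℝ × ℝ) (x : ℝ × ℝ) : ℝ :=
  LinearMap.det ((fderiv ℝ F x) : (ℝ × ℝ) →ₗ[ℝ] (ℝ × ℝ))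

/-- The Piola matrix `A(x) = DF(x) / det DF(x)`. -/
def Amap (F : ℝ × ℝ → ℝ × ℝ) (x : ℝ × ℝ) : (ℝ × ℝ) →L[ℝ] (ℝ × ℝ) :=
  (jacDet F x)⁻¹ • fderiv ℝ F x

/-- `B(x) = det DF(x) · (DF(x))⁻¹`, the adjugate of `DF`. -/
def Bmap (F : ℝ × ℝ → ℝ × ℝ) (x : ℝ × ℝ) : (ℝ × ℝ) →L[ℝ] (ℝ × ℝ) :=
  jacDet F x • Ring.inverse (fderiv ℝ F x)

/-- `v` is the Piola transform of `v̂` under `F`. -/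
def IsPiola (F vh v : ℝ × ℝ → ℝ × ℝ) : Prop :=
  ∀ x ∈ closure Tref, v (F x) = Amap F x (vh x)

/-- The `W^{m,p}` seminorm over a set `S` (for `p < ∞`). -/
def semiLp {E : Type*} [NormedAddCommGroup E] [NormedSpace ℝ E]
    (m : ℕ) (p : ℝ) (w : ℝ × ℝ → E) (S : Set (ℝ × ℝ)) : ℝ :=
  (∫ x in S, ‖iteratedFDeriv ℝ m w x‖ ^ p) ^ (1 / p)

/-- The `W^{m,p}` norm over a set `S`: the sum of the seminorms up to order `m`. -/
def normWmp {E : Type*} [NormedAddCommGroup E] [NormedSpace ℝ E]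
    (m : ℕ) (p : ℝ) (w : ℝ × ℝ → E) (S : Set (ℝ × ℝ)) : ℝ :=
  ∑ j ∈ Finset.range (m + 1), semiLp j p w S

/-- The isoparametric bounds of order `k` with constants `CF, c₁, c₂` and parameter `h`. -/
def IsoparamBounds (k : ℕ) (CF c₁ c₂ h : ℝ) (F : ℝ × ℝ → ℝ × ℝ) : Prop :=
  InjOn F (closure Tref) ∧
  (∀ m : ℕ, m ≤ k → ∀ x ∈ Tref, ‖iteratedFDeriv ℝ m F x‖ ≤ CF * h ^ m) ∧
  (∀ m : ℕ, m ≤ k + 1 → ∀ y ∈ F '' Tref,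
    ‖iteratedFDeriv ℝ m (invFunOn F (closure Tref)) y‖ ≤ CF * h ^ (-(m : ℤ))) ∧
  (∀ x ∈ closure Tref, c₁ * h ^ 2 ≤ jacDet F x ∧ jacDet F x ≤ c₂ * h ^ 2)

/-- The (planar) divergence of a vector field. -/
def pdiv (w : ℝ × ℝ → ℝ × ℝ) (x : ℝ × ℝ) : ℝ :=
  (fderiv ℝ w x (1, 0)).1 + (fderiv ℝ w x (0, 1)).2


section helpers
open Filter Topology

/-- Smooth with vanishing derivatives of order above `n`. -/
def PolyLike (n : ℕ) (f : ℝ × ℝ → ℝ) : Prop :=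
  ContDiff ℝ (⊤ : ℕ∞) f ∧ ∀ i, n < i → ∀ x, iteratedFDeriv ℝ i f x = 0

lemma polyLike_const (n : ℕ) (c : ℝ) : PolyLike n (fun _ => c) := by
  refine ⟨contDiff_const, fun i hi x => ?_⟩
  rw [iteratedFDeriv_const_of_ne (by omega)]
  rfl

lemma polyLike_clm (L : ℝ × ℝ →L[ℝ] ℝ) : PolyLike 1 (fun x => L x) := by
  refine ⟨L.contDiff, fun i hi x => ?_⟩
  obtain ⟨j, rfl⟩ : ∃ j, i = j + 1 := ⟨i - 1, by omega⟩
  rw [← norm_eq_zero, ← norm_iteratedFDeriv_fderiv]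
  have : fderiv ℝ (fun x => L x) = fun _ => L := by
    funext y; exact L.fderiv
  rw [this, iteratedFDeriv_const_of_ne (by omega)]
  simp

lemma PolyLike.mul {a b : ℕ} {f g : ℝ × ℝ → ℝ} (hf : PolyLike a f) (hg : PolyLike b g) :
    PolyLike (a + b) (fun x => f x * g x) := by
  refine ⟨hf.1.mul hg.1, fun i hi x => ?_⟩
  rw [← norm_eq_zero]
  refine le_antisymm ?_ (norm_nonneg _)
  refine (norm_iteratedFDeriv_mul_le hf.1 hg.1 x (n := i) (by exact_mod_cast le_top)).trans ?_
  refine (Finset.sum_eq_zero fun j hj => ?_).le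
  by_cases h : a < j
  · simp [hf.2 j h x]
  · simp [hg.2 (i - j) (by omega) x]

lemma PolyLike.pow {a : ℕ} {f : ℝ × ℝ → ℝ} (hf : PolyLike a f) (n : ℕ) :
    PolyLike (a * n) (fun x => f x ^ n) := by
  induction n with
  | zero => simpa using polyLike_const 0 1
  | succ n ih => simpa [pow_succ, mul_add] using ih.mul hf

lemma PolyLike.mono {a b : ℕ} {f : ℝ × ℝ → ℝ} (hf : PolyLike a f) (h : a ≤ b) : PolyLike b f :=
  ⟨hf.1, fun i hi x => hf.2 i (by omega) x⟩

lemma polyLike_sum {ι : Type*} (s : Finset ι) {a : ℕ} {f : ι → ℝ × ℝ → ℝ}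
    (hf : ∀ i ∈ s, PolyLike a (f i)) : PolyLike a (fun x => ∑ i ∈ s, f i x) := by
  refine ⟨ContDiff.sum fun i hi => (hf i hi).1, fun i hi x => ?_⟩
  rw [iteratedFDeriv_fun_sum_apply]
  · exact Finset.sum_eq_zero fun j hj => (hf j hj).2 i hi x
  · intro j hj
    exact ((hf j hj).1.of_le (by exact_mod_cast le_top)).contDiffAt

lemma polyLike_eval (P : MvPolynomial (Fin 2) ℝ) {k : ℕ} (hP : P.totalDegree ≤ k) :
    PolyLike k (fun x : ℝ × ℝ => MvPolynomial.eval ![x.1, x.2] P) := by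
  have e : (fun x : ℝ × ℝ => MvPolynomial.eval ![x.1, x.2] P) =
      fun x => ∑ d ∈ P.support, P.coeff d * (x.1 ^ d 0 * x.2 ^ d 1) := by
    funext x
    rw [MvPolynomial.eval_eq']
    simp [Fin.prod_univ_two]
  rw [e]
  refine polyLike_sum _ fun d hd => ?_
  have h1 := ((polyLike_clm (ContinuousLinearMap.fst ℝ ℝ ℝ)).pow (d 0)).mul
    ((polyLike_clm (ContinuousLinearMap.snd ℝ ℝ ℝ)).pow (d 1))
  refine ((polyLike_const 0 (P.coeff d)).mul h1).mono ?_
  have := MvPolynomial.le_totalDegree hd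
  rw [Finsupp.sum_fintype _ _ (by simp)] at this
  simp [Fin.sum_univ_two] at this
  omega

lemma IsPolyMap.contDiff {k : ℕ} {F : ℝ × ℝ → ℝ × ℝ} (h : IsPolyMap k F) :
    ContDiff ℝ (⊤ : ℕ∞) F := by
  obtain ⟨P, Q, hP, hQ, hF⟩ := h
  have : F = fun x => (MvPolynomial.eval ![x.1, x.2] P, MvPolynomial.eval ![x.1, x.2] Q) :=
    funext hF
  rw [this]
  exact (polyLike_eval P hP).1.prodMk (polyLike_eval Q hQ).1

lemma IsPolyMap.iteratedFDeriv_zero {k : ℕ} {F : ℝ × ℝ → ℝ × ℝ} (h : IsPolyMap k F)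
    {i : ℕ} (hi : k < i) (x : ℝ × ℝ) : iteratedFDeriv ℝ i F x = 0 := by
  obtain ⟨P, Q, hP, hQ, hF⟩ := h
  have : F = fun x => (MvPolynomial.eval ![x.1, x.2] P, MvPolynomial.eval ![x.1, x.2] Q) :=
    funext hF
  rw [this, iteratedFDeriv_prodMk (n := (⊤ : ℕ∞)) (polyLike_eval P hP).1.contDiffAt
    (polyLike_eval Q hQ).1.contDiffAt (by exact_mod_cast le_top),
    (polyLike_eval P hP).2 i hi x, (polyLike_eval Q hQ).2 i hi x]
  rfl

lemma isOpen_Tref : IsOpen Tref := by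
  have h1 : IsOpen {x : ℝ × ℝ | 0 < x.1} := isOpen_lt (by fun_prop) (by fun_prop)
  have h2 : IsOpen {x : ℝ × ℝ | 0 < x.2} := isOpen_lt (by fun_prop) (by fun_prop)
  have h3 : IsOpen {x : ℝ × ℝ | x.1 + x.2 < 1} := isOpen_lt (by fun_prop) (by fun_prop)
  exact h1.inter (h2.inter h3)

lemma isCompact_closure_Tref : IsCompact (closure Tref) := by
  have : Tref ⊆ Set.Icc (0 : ℝ) 1 ×ˢ Set.Icc (0 : ℝ) 1 := by
    rintro x ⟨h1, h2, h3⟩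
    exact ⟨⟨h1.le, by linarith⟩, ⟨h2.le, by linarith⟩⟩
  exact (isCompact_Icc.prod isCompact_Icc).closure_of_subset this

lemma exists_local {F what w : ℝ × ℝ → ℝ × ℝ} (hF : ContDiff ℝ (⊤ : ℕ∞) F)
    (hdet : ∀ x ∈ closure Tref, jacDet F x ≠ 0)
    {U : Set (ℝ × ℝ)} (hU : IsOpen U) (hTU : closure Tref ⊆ U)
    (hwhat : ContDiffOn ℝ (⊤ : ℕ∞) what U)
    (hw : ∀ x ∈ closure Tref, w (F x) = what x) (a : ℝ × ℝ) (ha : a ∈ closure Tref) :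
    ∃ w' : ℝ × ℝ → ℝ × ℝ, ContDiffAt ℝ (⊤ : ℕ∞) w' (F a) ∧
      ∀ᶠ x in 𝓝 a, x ∈ Tref → w =ᶠ[𝓝 (F x)] w' := by
  have hne : ((⊤ : ℕ∞) : WithTop ℕ∞) ≠ 0 := by simp
  have hs : ∀ x, x ∈ closure Tref → ∃ e : (ℝ × ℝ) ≃L[ℝ] (ℝ × ℝ),
      HasFDerivAt F (e : (ℝ × ℝ) →L[ℝ] (ℝ × ℝ)) x := by
    intro x hx
    refine ⟨(fderiv ℝ F x).toContinuousLinearEquivOfDetNeZero (hdet x hx), ?_⟩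
    exact (hF.differentiable hne x).hasFDerivAt
  obtain ⟨e, he⟩ := hs a ha
  have hFa : ContDiffAt ℝ (⊤ : ℕ∞) F a := hF.contDiffAt
  have hst := hFa.hasStrictFDerivAt' he hne
  set G := hFa.localInverse he hne with hG
  have hGa : G (F a) = a := hFa.localInverse_apply_image he hne
  have hleft : ∀ᶠ x in 𝓝 a, G (F x) = x := hst.eventually_left_inverse
  refine ⟨what ∘ G, ?_, ?_⟩
  · refine ContDiffAt.comp (F a) ?_ (hFa.to_localInverse he hne)
    change ContDiffAt ℝ _ what (G (F a))
    rw [hGa]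
    exact hwhat.contDiffAt (hU.mem_nhds (hTU ha))
  · filter_upwards [hleft.eventually_nhds] with x hx hxT
    obtain ⟨e', he'⟩ := hs x (subset_closure hxT)
    have hst' := (hF.contDiffAt (x := x)).hasStrictFDerivAt' he' hne
    rw [Filter.EventuallyEq, ← hst'.map_nhds_eq_of_equiv, Filter.eventually_map]
    filter_upwards [hx, isOpen_Tref.mem_nhds hxT] with z hz hzT
    simp [hz, hw z (subset_closure hzT)]

lemma exists_bound {F w : ℝ × ℝ → ℝ × ℝ} (hF : Continuous F)
    (hloc : ∀ a ∈ closure Tref, ∃ w' : ℝ × ℝ → ℝ × ℝ, ContDiffAt ℝ (⊤ : ℕ∞) w' (F a) ∧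
      ∀ᶠ x in 𝓝 a, x ∈ Tref → w =ᶠ[𝓝 (F x)] w') (r : ℕ) :
    ∃ M : ℝ, ∀ x ∈ Tref, ‖iteratedFDeriv ℝ r w (F x)‖ ≤ M := by
  suffices h : ∃ M : ℝ, ∀ x ∈ closure Tref, x ∈ Tref → ‖iteratedFDeriv ℝ r w (F x)‖ ≤ M by
    obtain ⟨M, hM⟩ := h
    exact ⟨M, fun x hx => hM x (subset_closure hx) hx⟩
  refine isCompact_closure_Tref.induction_on
    (p := fun S => ∃ M : ℝ, ∀ x ∈ S, x ∈ Tref → ‖iteratedFDeriv ℝ r w (F x)‖ ≤ M)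
    ⟨0, by simp⟩ ?_ ?_ ?_
  · rintro s t hst ⟨M, hM⟩
    exact ⟨M, fun x hx => hM x (hst hx)⟩
  · rintro s t ⟨M, hM⟩ ⟨N, hN⟩
    refine ⟨max M N, ?_⟩
    rintro x (hx | hx) hT
    · exact (hM x hx hT).trans (le_max_left _ _)
    · exact (hN x hx hT).trans (le_max_right _ _)
  · intro a ha
    obtain ⟨w', hw', hev⟩ := hloc a ha
    have hc : ContinuousAt (fun x => ‖iteratedFDeriv ℝ r w' (F x)‖) a :=
      (ContinuousAt.comp (f := F) (hw'.continuousAt_iteratedFDeriv (k := r)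
        (by exact_mod_cast le_top)) hF.continuousAt).norm
    have hb := hc.eventually_lt (continuousAt_const (y := ‖iteratedFDeriv ℝ r w' (F a)‖ + 1))
      (by linarith)
    refine ⟨_, mem_nhdsWithin_of_mem_nhds (hev.and hb), ‖iteratedFDeriv ℝ r w' (F a)‖ + 1, ?_⟩
    rintro x ⟨h1, h2⟩ hT
    rw [((h1 hT).iteratedFDeriv ℝ r).eq_of_nhds]
    exact h2.le

lemma isOpen_image_Tref {F : ℝ × ℝ → ℝ × ℝ} (hF : ContDiff ℝ (⊤ : ℕ∞) F)
    (hdet : ∀ x ∈ closure Tref, jacDet F x ≠ 0) : IsOpen (F '' Tref) := by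
  have hne : ((⊤ : ℕ∞) : WithTop ℕ∞) ≠ 0 := by simp
  rw [isOpen_iff_mem_nhds]
  rintro _ ⟨x, hx, rfl⟩
  have he : HasFDerivAt F (((fderiv ℝ F x).toContinuousLinearEquivOfDetNeZero
      (hdet x (subset_closure hx)) : (ℝ × ℝ) ≃L[ℝ] (ℝ × ℝ)) : (ℝ × ℝ) →L[ℝ] (ℝ × ℝ)) x := by
    exact (hF.differentiable hne x).hasFDerivAt
  rw [← ((hF.contDiffAt (x := x)).hasStrictFDerivAt' he hne).map_nhds_eq_of_equiv]
  exact Filter.image_mem_map (isOpen_Tref.mem_nhds hx)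

lemma pointwise_bound {k m : ℕ} {CF h : ℝ} (hh : 0 < h) {F what w : ℝ × ℝ → ℝ × ℝ}
    (hP : IsPolyMap k F)
    (hB : ∀ m : ℕ, m ≤ k → ∀ x ∈ Tref, ‖iteratedFDeriv ℝ m F x‖ ≤ CF * h ^ m)
    (hopen : IsOpen (F '' Tref)) (hwC : ContDiffOn ℝ (⊤ : ℕ∞) w (F '' Tref))
    (hw : ∀ x ∈ closure Tref, w (F x) = what x) (x : ℝ × ℝ) (hx : x ∈ Tref) :
    ‖iteratedFDeriv ℝ m what x‖ ≤ (m.factorial * max CF 1 ^ m) * h ^ m *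
      ∑ r ∈ Finset.range (m + 1), ‖iteratedFDeriv ℝ r w (F x)‖ := by
  have heq : what =ᶠ[𝓝 x] w ∘ F := by
    filter_upwards [isOpen_Tref.mem_nhds hx] with z hz
    exact (hw z (subset_closure hz)).symm
  rw [(heq.iteratedFDeriv ℝ m).eq_of_nhds, ← iteratedFDerivWithin_of_isOpen m isOpen_Tref hx]
  have key := norm_iteratedFDerivWithin_comp_le (n := m) (s := Tref) (t := F '' Tref)
    (x := x) (D := max CF 1 * h)
    (C := ∑ r ∈ Finset.range (m + 1), ‖iteratedFDeriv ℝ r w (F x)‖)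
    hwC (hP.contDiff.contDiffOn (s := Tref)) (by exact_mod_cast le_top) hopen.uniqueDiffOn
    isOpen_Tref.uniqueDiffOn (mapsTo_image F Tref) hx ?_ ?_
  · refine key.trans (le_of_eq ?_)
    rw [mul_pow]; ring
  · intro i hi
    rw [iteratedFDerivWithin_of_isOpen i hopen (mem_image_of_mem F hx)]
    exact Finset.single_le_sum (f := fun r => ‖iteratedFDeriv ℝ r w (F x)‖)
      (fun _ _ => norm_nonneg _) (Finset.mem_range.2 (by omega))
  · intro i h1 him
    rw [iteratedFDerivWithin_of_isOpen i isOpen_Tref hx]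
    by_cases hik : i ≤ k
    · refine (hB i hik x hx).trans ?_
      rw [mul_pow]
      refine mul_le_mul_of_nonneg_right ?_ (by positivity)
      exact (le_max_left _ _).trans (le_self_pow₀ (le_max_right _ _) (by omega))
    · rw [hP.iteratedFDeriv_zero (by omega)]
      simp only [norm_zero]
      positivity

lemma final_calc {m : ℕ} {p c₁ B h I : ℝ} (hp : 1 ≤ p) (hc₁ : 0 < c₁) (hB : 0 ≤ B)
    (hh : 0 < h) (hI0 : 0 ≤ I) {J : ℕ → ℝ} (hJ : ∀ r, 0 ≤ J r)
    (hI : I ≤ (B * h ^ m) ^ p * (((m + 1 : ℕ) : ℝ) ^ (p - 1)) * ((c₁ * h ^ 2)⁻¹ *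
      ∑ r ∈ Finset.range (m + 1), J r)) :
    I ^ (1 / p) ≤ (B * (((m + 1 : ℕ) : ℝ) ^ (p - 1) * c₁⁻¹ * (m + 1 : ℕ)) ^ (1 / p)) *
      h ^ ((m : ℝ) - 2 / p) * ∑ r ∈ Finset.range (m + 1), J r ^ (1 / p) := by
  have hp0 : 0 < p := by linarith
  set S := ∑ r ∈ Finset.range (m + 1), J r ^ (1 / p) with hS
  have hS0 : 0 ≤ S := Finset.sum_nonneg fun r _ => Real.rpow_nonneg (hJ r) _
  have hsum : ∑ r ∈ Finset.range (m + 1), J r ≤ (m + 1 : ℕ) * S ^ p := by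
    have : ∀ r ∈ Finset.range (m + 1), J r ≤ S ^ p := by
      intro r hr
      have h1 : J r ^ (1 / p) ≤ S := Finset.single_le_sum (f := fun r => J r ^ (1 / p))
        (fun r _ => Real.rpow_nonneg (hJ r) _) hr
      have h2 := Real.rpow_le_rpow (Real.rpow_nonneg (hJ r) _) h1 hp0.le
      rwa [← Real.rpow_mul (hJ r), one_div_mul_cancel hp0.ne', Real.rpow_one] at h2
    refine (Finset.sum_le_card_nsmul _ _ _ this).trans (le_of_eq ?_)
    simp
  set N : ℝ := ((m + 1 : ℕ) : ℝ) with hN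
  have hN0 : 0 < N := by rw [hN]; positivity
  have h1 : I ≤ (B * h ^ m) ^ p * (N ^ (p - 1) * c₁⁻¹ * N) * (h ^ 2)⁻¹ * S ^ p := by
    refine hI.trans ?_
    calc _ ≤ (B * h ^ m) ^ p * (N ^ (p - 1)) * ((c₁ * h ^ 2)⁻¹ * (N * S ^ p)) := by gcongr
      _ = _ := by rw [mul_inv]; ring
  refine (Real.rpow_le_rpow hI0 h1 (by positivity)).trans (le_of_eq ?_)
  rw [Real.mul_rpow (by positivity) (by positivity), Real.mul_rpow (by positivity) (by positivity),
    Real.mul_rpow (by positivity) (by positivity),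
    ← Real.rpow_mul (by positivity), ← Real.rpow_mul hS0, mul_one_div_cancel hp0.ne',
    Real.rpow_one, Real.rpow_one, Real.rpow_sub hh, Real.rpow_natCast,
    Real.inv_rpow (by positivity), ← Real.rpow_natCast h 2, ← Real.rpow_mul hh.le]
  have : ((2 : ℕ) : ℝ) * (1 / p) = 2 / p := by push_cast; ring
  rw [this]
  ring

end helpers

/-- Scaling estimate (Bernardi): `|ŵ|_{W^{m,p}(K̂)} ≤ C h^{m−2/p} Σ_{r≤m} |w|_{W^{r,p}(K)}`
for `w = ŵ ∘ F⁻¹`. -/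
theorem stmt3 (k m : ℕ) (hk : 2 ≤ k) (p : ℝ) (hp : 1 ≤ p) (CF c₁ c₂ : ℝ)
    (hCF : 0 < CF) (hc₁ : 0 < c₁) (hc₂ : 0 < c₂) :
    ∃ C : ℝ, 0 < C ∧ ∀ h : ℝ, h ∈ Set.Ioc (0 : ℝ) 1 → ∀ F : ℝ × ℝ → ℝ × ℝ,
      IsPolyMap k F → IsoparamBounds k CF c₁ c₂ h F →
      ∀ Khat : Set (ℝ × ℝ), Khat ⊆ Tref → MeasurableSet Khat →
      ∀ what : ℝ × ℝ → ℝ × ℝ,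
        (∃ U : Set (ℝ × ℝ), IsOpen U ∧ closure Tref ⊆ U ∧ ContDiffOn ℝ (⊤ : ℕ∞) what U) →
      ∀ w : ℝ × ℝ → ℝ × ℝ, (∀ x ∈ closure Tref, w (F x) = what x) →
      semiLp m p what Khat ≤
        C * h ^ ((m : ℝ) - 2 / p) *
          ∑ r ∈ Finset.range (m + 1), semiLp r p w (F '' Khat) := by
  have hp0 : 0 < p := by linarith
  set B : ℝ := m.factorial * max CF 1 ^ m with hBdef
  have hBpos : 0 < B := by positivity
  refine ⟨B * (((m + 1 : ℕ) : ℝ) ^ (p - 1) * c₁⁻¹ * (m + 1 : ℕ)) ^ (1 / p), by positivity, ?_⟩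
  rintro h ⟨hh, -⟩ F hP ⟨hinj, hB, -, hdetb⟩ Khat hK hKm what ⟨U, hU, hTU, hwhat⟩ w hw
  have hF := hP.contDiff
  have hne : ((⊤ : ℕ∞) : WithTop ℕ∞) ≠ 0 := by simp
  have hdet : ∀ x ∈ closure Tref, jacDet F x ≠ 0 := fun x hx =>
    (lt_of_lt_of_le (by positivity) (hdetb x hx).1).ne'
  have hloc := exists_local hF hdet hU hTU hwhat hw
  have hopen := isOpen_image_Tref hF hdet
  have hwAt : ∀ y ∈ F '' Tref, ContDiffAt ℝ (⊤ : ℕ∞) w y := by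
    rintro _ ⟨x, hx, rfl⟩
    obtain ⟨w', h1, h2⟩ := hloc x (subset_closure hx)
    exact h1.congr_of_eventuallyEq (h2.self_of_nhds hx)
  have hwC : ContDiffOn ℝ (⊤ : ℕ∞) w (F '' Tref) := fun y hy => (hwAt y hy).contDiffWithinAt
  have hpt := pointwise_bound (m := m) hh hP hB hopen hwC hw
  have hder : ∀ x ∈ Khat, HasFDerivWithinAt F (fderiv ℝ F x) Khat x := fun x _ =>
    (hF.differentiable hne x).hasFDerivAt.hasFDerivWithinAt
  have hinjK : InjOn F Khat := hinj.mono (hK.trans subset_closure)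
  have hFK : MeasurableSet (F '' Khat) := hKm.image_of_continuousOn_injOn
    hF.continuous.continuousOn hinjK
  have hint : ∀ r, IntegrableOn (fun y => ‖iteratedFDeriv ℝ r w y‖ ^ p) (F '' Khat) := by
    intro r
    obtain ⟨M, hM⟩ := exists_bound hF.continuous hloc r
    have hcont : ContinuousOn (fun y => ‖iteratedFDeriv ℝ r w y‖ ^ p) (F '' Tref) := by
      intro y hy
      refine ContinuousAt.continuousWithinAt ?_
      exact (((hwAt y hy).continuousAt_iteratedFDeriv (k := r)
        (by exact_mod_cast le_top)).norm).rpow_const (Or.inr hp0.le)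
    have hfin : volume (F '' Khat) < ⊤ := by
      refine lt_of_le_of_lt (measure_mono (image_mono (hK.trans subset_closure))) ?_
      exact (isCompact_closure_Tref.image hF.continuous).measure_lt_top
    refine IntegrableOn.of_bound hfin
      ((hcont.mono (image_mono hK)).aestronglyMeasurable hFK) (M ^ p) ?_
    refine (ae_restrict_iff' hFK).2 (Filter.Eventually.of_forall ?_)
    rintro _ ⟨x, hx, rfl⟩
    rw [Real.norm_of_nonneg (by positivity)]
    exact Real.rpow_le_rpow (norm_nonneg _) (hM x (hK hx)) hp0.le
  refine final_calc hp hc₁ hBpos.le hh (by positivity) (fun r => by positivity) ?_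
  rw [← integral_finsetSum _ (fun r _ => hint r),
    integral_image_eq_integral_abs_det_fderiv_smul volume hKm hder hinjK,
    ← integral_const_mul, ← integral_const_mul]
  refine integral_mono_of_nonneg (Filter.Eventually.of_forall fun x => by positivity) ?_ ?_
  · refine Integrable.const_mul (Integrable.const_mul ?_ _) _
    exact (integrableOn_image_iff_integrableOn_abs_det_fderiv_smul volume hKm hder hinjK
      (fun y => ∑ r ∈ Finset.range (m + 1), ‖iteratedFDeriv ℝ r w y‖ ^ p)).1
      (integrable_finsetSum _ fun r _ => hint r)
  · refine (ae_restrict_iff' hKm).2 (Filter.Eventually.of_forall fun x hx => ?_)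
    have hd : c₁ * h ^ 2 ≤ |(fderiv ℝ F x).det| :=
      (hdetb x (subset_closure (hK hx))).1.trans (le_abs_self _)
    set Sp := ∑ r ∈ Finset.range (m + 1), ‖iteratedFDeriv ℝ r w (F x)‖ ^ p with hSp
    have hSp0 : 0 ≤ Sp := Finset.sum_nonneg fun r _ => by positivity
    have h1 : Sp ≤ (c₁ * h ^ 2)⁻¹ * (|(fderiv ℝ F x).det| * Sp) := by
      rw [← mul_assoc]
      refine le_mul_of_one_le_left hSp0 ?_
      rw [inv_mul_eq_div, one_le_div (by positivity)]
      exact hd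
    have h2 : (∑ r ∈ Finset.range (m + 1), ‖iteratedFDeriv ℝ r w (F x)‖) ^ p ≤
        ((m + 1 : ℕ) : ℝ) ^ (p - 1) * Sp := by
      have := Real.rpow_sum_le_const_mul_sum_rpow (Finset.range (m + 1))
        (fun r => ‖iteratedFDeriv ℝ r w (F x)‖) hp
      simpa only [abs_norm, Finset.card_range] using this
    have h3 := Real.rpow_le_rpow (norm_nonneg _) (hpt x (hK hx)) hp0.le
    rw [Real.mul_rpow (by positivity) (Finset.sum_nonneg fun r _ => norm_nonneg _)] at h3
    refine h3.trans ?_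
    simp only [smul_eq_mul]
    rw [mul_assoc _ (((m + 1 : ℕ) : ℝ) ^ (p - 1))]
    refine mul_le_mul_of_nonneg_left (h2.trans ?_) (by positivity)
    exact mul_le_mul_of_nonneg_left h1 (by positivity)
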